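/- Cascades of incrementally input-to-state stable discrete-time systems are incrementally input-to-state stable: let the first subsystem be x_1(k+1) = F_1(x_1(k), u(k)) with output y_1(k) = H_1(x_1(k), u(k)), where F_1 is continuous, H_1 is globally Lipschitz, and the first subsystem is incrementally ISS with respect to the input u; let the second subsystem be x_2(k+1) = F_2(x_2(k), v(k)) with F_2 continuous and incrementally ISS with respect to its input v. Then the cascade system with state (x_1, x_2), input u, and dynamics x_1(k+1) = F_1(x_1(k), u(k)), x_2(k+1) = F_2(x_2(k), H_1(x_1(k), u(k))) is incrementally input-to-state stable with respect to u: there exist β of class 𝒦𝓛 and γ of class 𝒦 such that for all pairs of initial states and all pairs of input sequences u_1, u_2, the distance between the two cascade trajectories at time k is at most β(distance of initial states, k) + γ(sup_j ‖u_1(j) − u_2(j)‖). -/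

import Mathlib

open Filter

/-- Trajectory of the discrete-time system `x(k+1) = F (x k) (u k)` from initial state `ξ`
under input sequence `u`. -/
def trajectory {S U : Type*} (F : S → U → S) (ξ : S) (u : ℕ → U) : ℕ → S
  | 0 => ξ
  | k + 1 => F (trajectory F ξ u k) (u k)

/-- A function `γ : [0,∞) → [0,∞)` is of class 𝒦 if it is continuous, (strictly)
increasing and `γ 0 = 0`. -/
def ClassK (γ : ℝ → ℝ) : Prop :=
  ContinuousOn γ (Set.Ici 0) ∧ StrictMonoOn γ (Set.Ici 0) ∧ γ 0 = 0

/-- A continuous function `β : [0,∞) × [0,∞) → [0,∞)` is of class 𝒦𝓛 if `β (·, t)` is of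
class 𝒦 for every fixed `t ≥ 0` and, for every fixed `s ≥ 0`, `β (s, ·)` is nonincreasing
and tends to `0` at infinity. -/
def ClassKL (β : ℝ → ℝ → ℝ) : Prop :=
  ContinuousOn (fun q : ℝ × ℝ => β q.1 q.2) (Set.Ici 0 ×ˢ Set.Ici 0) ∧
  (∀ t, 0 ≤ t → ClassK fun s => β s t) ∧
  ∀ s, 0 ≤ s → AntitoneOn (β s) (Set.Ici 0) ∧ Tendsto (β s) atTop (nhds 0)

/-- The system `x(k+1) = F (x k) (u k)` satisfies the incremental input-to-state-stability
estimate with a given comparison pair `(β, γ)`: for any pair of initial conditions and any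
pair of input sequences, the distance of trajectories at time `k` is at most
`β ‖ξ₁ - ξ₂‖ k + γ (sup_j ‖u₁ j - u₂ j‖)` (expressed via any uniform bound `M` on the
input differences). -/
def IncISSWith {S U : Type*} [NormedAddCommGroup S] [NormedAddCommGroup U]
    (β : ℝ → ℝ → ℝ) (γ : ℝ → ℝ) (F : S → U → S) : Prop :=
  ∀ ξ₁ ξ₂ : S, ∀ u₁ u₂ : ℕ → U, ∀ k : ℕ, ∀ M : ℝ,
    (∀ j, ‖u₁ j - u₂ j‖ ≤ M) →
    ‖trajectory F ξ₁ u₁ k - trajectory F ξ₂ u₂ k‖ ≤ β ‖ξ₁ - ξ₂‖ (k : ℝ) + γ M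

/-- A discrete-time system `x(k+1) = F (x k) (u k)` with continuous `F` is (globally)
incrementally input-to-state stable if there are `β` of class 𝒦𝓛 and `γ` of class 𝒦
realizing the incremental ISS estimate. -/
def IncrementallyISS {S U : Type*} [NormedAddCommGroup S] [NormedAddCommGroup U]
    (F : S → U → S) : Prop :=
  Continuous (fun q : S × U => F q.1 q.2) ∧
  ∃ β : ℝ → ℝ → ℝ, ∃ γ : ℝ → ℝ, ClassKL β ∧ ClassK γ ∧ IncISSWith β γ F

theorem ClassK.nonneg {γ : ℝ → ℝ} (h : ClassK γ) {r : ℝ} (hr : 0 ≤ r) : 0 ≤ γ r := by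
  have := h.2.1.monotoneOn (Set.mem_Ici.2 le_rfl) (Set.mem_Ici.2 hr) hr
  rwa [h.2.2] at this

theorem ClassK.mono {γ : ℝ → ℝ} (h : ClassK γ) {r s : ℝ} (hr : 0 ≤ r) (hrs : r ≤ s) :
    γ r ≤ γ s :=
  h.2.1.monotoneOn (Set.mem_Ici.2 hr) (Set.mem_Ici.2 (hr.trans hrs)) hrs

theorem ClassK.mapsTo {γ : ℝ → ℝ} (h : ClassK γ) :
    Set.MapsTo γ (Set.Ici 0) (Set.Ici 0) :=
  fun _ hr => h.nonneg hr

theorem ClassK.comp {γ δ : ℝ → ℝ} (hγ : ClassK γ) (hδ : ClassK δ) :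
    ClassK fun r => γ (δ r) :=
  ⟨hγ.1.comp hδ.1 hδ.mapsTo, hγ.2.1.comp hδ.2.1 hδ.mapsTo, by simp [hγ.2.2, hδ.2.2]⟩

theorem ClassK.add {γ δ : ℝ → ℝ} (hγ : ClassK γ) (hδ : ClassK δ) :
    ClassK fun r => γ r + δ r :=
  ⟨hγ.1.add hδ.1, hγ.2.1.add hδ.2.1, by simp [hγ.2.2, hδ.2.2]⟩

theorem classK_const_mul {c : ℝ} (hc : 0 < c) : ClassK fun r => c * r :=
  ⟨by fun_prop, fun _ _ _ _ h => mul_lt_mul_of_pos_left h hc, by simp⟩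

theorem classK_id : ClassK fun r => r :=
  ⟨continuousOn_id, fun _ _ _ _ h => h, rfl⟩

/-- Weak triangle inequality for class 𝒦 functions. -/
theorem ClassK.apply_add_le {γ : ℝ → ℝ} (h : ClassK γ) {a b : ℝ} (ha : 0 ≤ a) (hb : 0 ≤ b) :
    γ (a + b) ≤ γ (2 * a) + γ (2 * b) := by
  rcases le_total a b with hab | hab
  · have h₁ : γ (a + b) ≤ γ (2 * b) := h.mono (by positivity) (by linarith)
    have h₂ : 0 ≤ γ (2 * a) := h.nonneg (by positivity)
    linarith
  · have h₁ : γ (a + b) ≤ γ (2 * a) := h.mono (by positivity) (by linarith)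
    have h₂ : 0 ≤ γ (2 * b) := h.nonneg (by positivity)
    linarith

theorem ClassKL.nonneg {β : ℝ → ℝ → ℝ} (h : ClassKL β) {s t : ℝ} (hs : 0 ≤ s) (ht : 0 ≤ t) :
    0 ≤ β s t :=
  (h.2.1 t ht).nonneg hs

theorem ClassKL.le_of_le {β : ℝ → ℝ → ℝ} (h : ClassKL β) {s s' t t' : ℝ} (hs : 0 ≤ s)
    (hss' : s ≤ s') (ht : 0 ≤ t) (htt' : t ≤ t') : β s t' ≤ β s' t :=
  ((h.2.2 s hs).1 (Set.mem_Ici.2 ht) (Set.mem_Ici.2 (ht.trans htt')) htt').trans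
    ((h.2.1 t ht).mono hs hss')

theorem ClassKL.add {β β' : ℝ → ℝ → ℝ} (h : ClassKL β) (h' : ClassKL β') :
    ClassKL fun s t => β s t + β' s t :=
  ⟨h.1.add h'.1, fun t ht => (h.2.1 t ht).add (h'.2.1 t ht), fun s hs =>
    ⟨(h.2.2 s hs).1.add (h'.2.2 s hs).1, by simpa using (h.2.2 s hs).2.add (h'.2.2 s hs).2⟩⟩

theorem ClassK.comp_classKL {γ : ℝ → ℝ} {β : ℝ → ℝ → ℝ} (hγ : ClassK γ) (hβ : ClassKL β) :
    ClassKL fun s t => γ (β s t) := by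
  refine ⟨hγ.1.comp hβ.1 fun q hq => hβ.nonneg hq.1 hq.2, fun t ht => hγ.comp (hβ.2.1 t ht),
    fun s hs => ⟨fun t ht t' ht' htt' => hγ.mono (hβ.nonneg hs ht') (hβ.le_of_le hs le_rfl ht htt'),
      ?_⟩⟩
  have hγ₀ : Tendsto γ (nhdsWithin 0 (Set.Ici 0)) (nhds 0) := by
    simpa [ContinuousWithinAt, hγ.2.2] using hγ.1 0 (Set.mem_Ici.2 le_rfl)
  refine hγ₀.comp (tendsto_nhdsWithin_iff.2 ⟨(hβ.2.2 s hs).2, ?_⟩)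
  filter_upwards [eventually_ge_atTop 0] with t ht using hβ.nonneg hs ht

theorem ClassKL.comp {β : ℝ → ℝ → ℝ} {α τ : ℝ → ℝ} (hβ : ClassKL β) (hα : ClassK α)
    (hτ : Continuous τ) (hτ_mono : Monotone τ) (hτ_nonneg : ∀ t, 0 ≤ t → 0 ≤ τ t)
    (hτ_top : Tendsto τ atTop atTop) :
    ClassKL fun s t => β (α s) (τ t) := by
  refine ⟨?_, fun t ht => (hβ.2.1 _ (hτ_nonneg t ht)).comp hα, fun s hs =>
    ⟨fun t ht t' _ htt' => hβ.le_of_le (hα.nonneg hs) le_rfl (hτ_nonneg t ht) (hτ_mono htt'),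
      (hβ.2.2 _ (hα.nonneg hs)).2.comp hτ_top⟩⟩
  exact hβ.1.comp (f := fun q : ℝ × ℝ => (α q.1, τ q.2))
    ((hα.1.comp continuousOn_fst fun q hq => hq.1).prodMk (by fun_prop))
    fun q hq => ⟨hα.nonneg hq.1, hτ_nonneg _ hq.2⟩

theorem trajectory_add {S U : Type*} (F : S → U → S) (ξ : S) (u : ℕ → U) (m k : ℕ) :
    trajectory F ξ u (m + k) =
      trajectory F (trajectory F ξ u m) (fun j => u (m + j)) k := by
  induction k with
  | zero => rfl
  | succ k ih => rw [← Nat.add_assoc, trajectory, trajectory, ih]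

theorem trajectory_cascade {S₁ S₂ U V : Type*} (F₁ : S₁ → U → S₁) (H₁ : S₁ → U → V)
    (F₂ : S₂ → V → S₂) (ξ : S₁ × S₂) (u : ℕ → U) (k : ℕ) :
    trajectory (fun (x : S₁ × S₂) (v : U) => (F₁ x.1 v, F₂ x.2 (H₁ x.1 v))) ξ u k =
      (trajectory F₁ ξ.1 u k,
        trajectory F₂ ξ.2 (fun j => H₁ (trajectory F₁ ξ.1 u j) (u j)) k) := by
  induction k with
  | zero => rfl
  | succ k ih => simp only [trajectory, ih]

/-- Incremental ISS estimate restarted at an intermediate time `m`, after which the input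
difference is bounded by `N`, while over the whole horizon it is bounded by `M`. -/
theorem IncISSWith.norm_trajectory_add_sub_le {S U : Type*} [NormedAddCommGroup S]
    [NormedAddCommGroup U] {β : ℝ → ℝ → ℝ} {γ : ℝ → ℝ} {F : S → U → S}
    (h : IncISSWith β γ F) (hβ : ClassKL β) (ξ₁ ξ₂ : S) (u₁ u₂ : ℕ → U) (m k : ℕ) {M N : ℝ}
    (hM : ∀ j, ‖u₁ j - u₂ j‖ ≤ M) (hN : ∀ j, ‖u₁ (m + j) - u₂ (m + j)‖ ≤ N) :
    ‖trajectory F ξ₁ u₁ (m + k) - trajectory F ξ₂ u₂ (m + k)‖ ≤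
      β (β ‖ξ₁ - ξ₂‖ 0 + γ M) k + γ N := by
  rw [trajectory_add, trajectory_add]
  refine (h _ _ _ _ k N hN).trans ?_
  gcongr
  refine hβ.le_of_le (norm_nonneg _) ((h _ _ _ _ m M hM).trans ?_) k.cast_nonneg le_rfl
  gcongr
  exact hβ.le_of_le (norm_nonneg _) le_rfl le_rfl m.cast_nonneg

theorem IncrementallyISS.cascade {S₁ S₂ U V : Type*} [NormedAddCommGroup S₁]
    [NormedAddCommGroup S₂] [NormedAddCommGroup U] [NormedAddCommGroup V]
    {F₁ : S₁ → U → S₁} {H₁ : S₁ → U → V} {F₂ : S₂ → V → S₂}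
    (hH₁ : ∃ K : NNReal, LipschitzWith K fun q : S₁ × U => H₁ q.1 q.2)
    (hF₁ : IncrementallyISS F₁) (hF₂ : IncrementallyISS F₂) :
    IncrementallyISS fun (x : S₁ × S₂) (u : U) => (F₁ x.1 u, F₂ x.2 (H₁ x.1 u)) := by
  obtain ⟨K, hK⟩ := hH₁
  obtain ⟨hF₁c, β₁, γ₁, hβ₁, hγ₁, h₁⟩ := hF₁
  obtain ⟨hF₂c, β₂, γ₂, hβ₂, hγ₂, h₂⟩ := hF₂
  have hL : (0 : ℝ) < K + 1 := by positivity
  set L : ℝ := K + 1 with hLdef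
  have hγ₂L : ClassK fun r => γ₂ (2 * (L * r)) :=
    hγ₂.comp ((classK_const_mul two_pos).comp (classK_const_mul hL))
  -- the transient and the steady-state bounds on the state of the second subsystem
  have hα : ClassK fun s => 2 * (β₂ s 0 + γ₂ (2 * (L * β₁ s 0))) :=
    (classK_const_mul two_pos).comp
      ((hβ₂.2.1 0 le_rfl).add (hγ₂L.comp (hβ₁.2.1 0 le_rfl)))
  have hρ : ClassK fun r => γ₂ (2 * (L * (γ₁ r + r))) := hγ₂L.comp (hγ₁.add classK_id)
  have hτ : Continuous fun t : ℝ => max (t - 1) 0 / 2 := by fun_prop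
  have hτ_mono : Monotone fun t : ℝ => max (t - 1) 0 / 2 := fun a b hab => by
    dsimp only; gcongr
  have hτ_top : Tendsto (fun t : ℝ => max (t - 1) 0 / 2) atTop atTop :=
    (tendsto_atTop_mono (fun t => le_max_left _ _)
      (tendsto_atTop_add_const_right _ (-1 : ℝ) tendsto_id)).atTop_div_const two_pos
  refine ⟨?_, fun s t => β₁ s t + (β₂ (2 * (β₂ s 0 + γ₂ (2 * (L * β₁ s 0)))) (t / 2) +
      γ₂ (2 * (L * β₁ s (max (t - 1) 0 / 2)))),
    fun r => γ₁ r + (β₂ (2 * γ₂ (2 * (L * (γ₁ r + r)))) 0 + γ₂ (2 * (L * (γ₁ r + r)))),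
    ?_, ?_, ?_⟩
  · have hH₁c := hK.continuous
    exact (hF₁c.comp (by fun_prop : Continuous fun q : (S₁ × S₂) × U => (q.1.1, q.2))).prodMk
      (hF₂c.comp ((by fun_prop : Continuous fun q : (S₁ × S₂) × U => q.1.2).prodMk
        (hH₁c.comp (by fun_prop : Continuous fun q : (S₁ × S₂) × U => (q.1.1, q.2)))))
  · refine hβ₁.add ((hβ₂.comp hα (τ := fun t => t / 2) (by fun_prop)
      (fun a b hab => by dsimp only; gcongr) (fun t ht => by positivity)
      (tendsto_id.atTop_div_const two_pos)).add
      (hγ₂L.comp_classKL (hβ₁.comp classK_id hτ hτ_mono (fun t _ => by positivity) hτ_top)))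
  · exact hγ₁.add (((hβ₂.2.1 0 le_rfl).comp ((classK_const_mul two_pos).comp hρ)).add hρ)
  · intro ξ η u w k M hM
    have hM₀ : 0 ≤ M := (norm_nonneg _).trans (hM 0)
    rw [trajectory_cascade, trajectory_cascade]
    set δ : ℝ := ‖ξ - η‖
    have hδ₀ : 0 ≤ δ := norm_nonneg _
    have hδ₁ : ‖ξ.1 - η.1‖ ≤ δ := norm_fst_le (ξ - η)
    have hδ₂ : ‖ξ.2 - η.2‖ ≤ δ := norm_snd_le (ξ - η)
    have hγM : 0 ≤ γ₁ M := hγ₁.nonneg hM₀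
    have hx₁ : ∀ (j : ℕ) (t : ℝ), 0 ≤ t → t ≤ j →
        ‖trajectory F₁ ξ.1 u j - trajectory F₁ η.1 w j‖ ≤ β₁ δ t + γ₁ M := fun j t ht htj =>
      (h₁ _ _ _ _ j M hM).trans <| by
        gcongr
        exact hβ₁.le_of_le (norm_nonneg _) hδ₁ ht htj
    have hv : ∀ (j : ℕ) (t : ℝ), 0 ≤ t → t ≤ j →
        ‖H₁ (trajectory F₁ ξ.1 u j) (u j) - H₁ (trajectory F₁ η.1 w j) (w j)‖ ≤
          L * β₁ δ t + L * (γ₁ M + M) := by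
      intro j t ht htj
      have hβ₀ : 0 ≤ β₁ δ t := hβ₁.nonneg hδ₀ ht
      refine (hK.norm_sub_le (trajectory F₁ ξ.1 u j, u j) (trajectory F₁ η.1 w j, w j)).trans ?_
      rw [← mul_add]
      refine mul_le_mul (by simp [hLdef]) ?_ (norm_nonneg _) hL.le
      exact max_le ((hx₁ j t ht htj).trans (by linarith)) ((hM j).trans (by linarith))
    have hγ_le : ∀ t : ℝ, 0 ≤ t → γ₂ (L * β₁ δ t + L * (γ₁ M + M)) ≤
        γ₂ (2 * (L * β₁ δ t)) + γ₂ (2 * (L * (γ₁ M + M))) := fun t ht =>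
      hγ₂.apply_add_le (mul_nonneg hL.le (hβ₁.nonneg hδ₀ ht)) (by positivity)
    have hx₂ : ‖trajectory F₂ ξ.2 (fun j => H₁ (trajectory F₁ ξ.1 u j) (u j)) k -
        trajectory F₂ η.2 (fun j => H₁ (trajectory F₁ η.1 w j) (w j)) k‖ ≤
        (β₂ (2 * (β₂ δ 0 + γ₂ (2 * (L * β₁ δ 0)))) (k / 2) +
          γ₂ (2 * (L * β₁ δ (max ((k : ℝ) - 1) 0 / 2)))) +
        (β₂ (2 * γ₂ (2 * (L * (γ₁ M + M)))) 0 + γ₂ (2 * (L * (γ₁ M + M)))) := by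
      obtain ⟨m, l, rfl, hml, hlm⟩ : ∃ m l : ℕ, k = m + l ∧ m ≤ l ∧ l ≤ m + 1 :=
        ⟨k / 2, k - k / 2, by omega, by omega, by omega⟩
      have hml' : (m : ℝ) ≤ l := mod_cast hml
      have hlm' : (l : ℝ) ≤ m + 1 := mod_cast hlm
      have hm₀ : (0 : ℝ) ≤ m := m.cast_nonneg
      set τ : ℝ := max (((m + l : ℕ) : ℝ) - 1) 0 / 2 with hτdef
      have hτ₀ : 0 ≤ τ := by positivity
      have hτm : τ ≤ m := by
        rw [hτdef, div_le_iff₀ two_pos]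
        push_cast
        exact max_le (by linarith) (by linarith)
      have key := h₂.norm_trajectory_add_sub_le hβ₂ ξ.2 η.2
        (fun j => H₁ (trajectory F₁ ξ.1 u j) (u j)) (fun j => H₁ (trajectory F₁ η.1 w j) (w j)) m l
        (fun j => hv j 0 le_rfl j.cast_nonneg)
        (fun j => hv (m + j) τ hτ₀ (hτm.trans (by simp)))
      have hα₀ : 0 ≤ β₂ δ 0 + γ₂ (2 * (L * β₁ δ 0)) := by linarith [hα.nonneg hδ₀]
      have hρ₀ : 0 ≤ γ₂ (2 * (L * (γ₁ M + M))) := hρ.nonneg hM₀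
      have hl : (0 : ℝ) ≤ ((m + l : ℕ) : ℝ) / 2 := by positivity
      have hll : ((m + l : ℕ) : ℝ) / 2 ≤ l := by push_cast; linarith
      have hstart : β₂ ‖ξ.2 - η.2‖ 0 + γ₂ (L * β₁ δ 0 + L * (γ₁ M + M)) ≤
          (β₂ δ 0 + γ₂ (2 * (L * β₁ δ 0))) + γ₂ (2 * (L * (γ₁ M + M))) := by
        linarith [hγ_le 0 le_rfl, hβ₂.le_of_le (norm_nonneg _) hδ₂ le_rfl le_rfl]
      have hstart₀ : 0 ≤ β₂ ‖ξ.2 - η.2‖ 0 + γ₂ (L * β₁ δ 0 + L * (γ₁ M + M)) :=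
        add_nonneg (hβ₂.nonneg (norm_nonneg _) le_rfl) (hγ₂.nonneg
          (add_nonneg (mul_nonneg hL.le (hβ₁.nonneg hδ₀ le_rfl)) (by positivity)))
      have e₁ := hβ₂.le_of_le hstart₀ hstart hl hll
      have e₂ := (hβ₂.2.1 _ hl).apply_add_le hα₀ hρ₀
      have e₃ := hβ₂.le_of_le (mul_nonneg zero_le_two hρ₀) le_rfl le_rfl hl
      linarith [hγ_le τ hτ₀]
    refine (max_le_add_of_nonneg (norm_nonneg _) (norm_nonneg _)).trans
      ((add_le_add (hx₁ k k k.cast_nonneg le_rfl) hx₂).trans_eq ?_)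
    ring

/-- Cascades of incrementally input-to-state stable discrete-time systems
are incrementally input-to-state stable: if the first subsystem
`x₁(k+1) = F₁ (x₁ k) (u k)` with globally Lipschitz output map `H₁` is incrementally ISS
with respect to `u`, and the second subsystem `x₂(k+1) = F₂ (x₂ k) (v k)` is incrementally
ISS with respect to its input `v`, then the cascade
`x₁(k+1) = F₁ (x₁ k) (u k)`, `x₂(k+1) = F₂ (x₂ k) (H₁ (x₁ k) (u k))`
is incrementally ISS with respect to `u`. -/
theorem cascade_incrementally_ISS (n₁ n₂ d p : ℕ)
    (F₁ : (Fin n₁ → ℝ) → (Fin d → ℝ) → (Fin n₁ → ℝ))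
    (H₁ : (Fin n₁ → ℝ) → (Fin d → ℝ) → (Fin p → ℝ))
    (F₂ : (Fin n₂ → ℝ) → (Fin p → ℝ) → (Fin n₂ → ℝ))
    (hH₁ : ∃ K : NNReal, LipschitzWith K fun q : (Fin n₁ → ℝ) × (Fin d → ℝ) => H₁ q.1 q.2)
    (hF₁ : IncrementallyISS F₁)
    (hF₂ : IncrementallyISS F₂) :
    IncrementallyISS (fun x : (Fin n₁ → ℝ) × (Fin n₂ → ℝ) => fun u : Fin d → ℝ =>
      (F₁ x.1 u, F₂ x.2 (H₁ x.1 u))) := by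
  exact IncrementallyISS.cascade hH₁ hF₁ hF₂
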